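/- arXiv:1510.00722 — 2 statements merged into one kernel-verified Lean document; each statement's English description precedes it below -/
import Mathlib

section
/- Let θ ∈ (0, π/2) and let R_θ ∈ O_2(ℝ) be the rotation of ℝ² of angle θ. If R_θ is totally irrational, then the rate of injectivity in time 1 satisfies τ^1(R_θ) = 1 − (cos θ + sin θ − 1)². -/
open Filter MeasureTheory
open scoped BigOperators

noncomputable section

/-- The projection `p : ℝ → ℤ`: the unique `k` with `k - 1/2 < x ≤ k + 1/2`. -/
def roundHalf (x : ℝ) : ℤ := ⌈x - 1/2⌉

/-- Coercion of an integer vector to a real vector. -/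
def intVec {n : ℕ} (v : Fin n → ℤ) : Fin n → ℝ := fun i => (v i : ℝ)

/-- The set of integer points of `ℝ^n`. -/
def intPoints (n : ℕ) : Set (Fin n → ℝ) := Set.range (intVec (n := n))

/-- The coordinatewise projection `π : ℝ^n → ℤ^n`. -/
def discretize {n : ℕ} (x : Fin n → ℝ) : Fin n → ℤ := fun i => roundHalf (x i)

/-- `π` viewed as a self-map of `ℝ^n`. -/
def discretizeR {n : ℕ} (x : Fin n → ℝ) : Fin n → ℝ := intVec (discretize x)

/-- The image of a set `Γ` under the discretization `P̂` of the matrix `P`. -/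
def PhatImg {n : ℕ} (P : Matrix (Fin n) (Fin n) ℝ) (Γ : Set (Fin n → ℝ)) :
    Set (Fin n → ℝ) :=
  (fun x => discretizeR (P.mulVec x)) '' Γ

/-- The uniform `R`-density `D_R^+`. Balls are sup-norm balls. -/
def DRplus {n : ℕ} (Γ : Set (Fin n → ℝ)) (R : ℝ) : ℝ :=
  ⨆ x : Fin n → ℝ,
    ((Metric.ball x R ∩ Γ).ncard : ℝ) / ((Metric.ball x R ∩ intPoints n).ncard : ℝ)

/-- Relatively dense with parameter `R₀`. -/
def RelativelyDenseWith {n : ℕ} (Γ : Set (Fin n → ℝ)) (R₀ : ℝ) : Prop :=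
  ∀ x : Fin n → ℝ, ∀ r, R₀ ≤ r → (Metric.ball x r ∩ Γ).Nonempty

def RelativelyDense {n : ℕ} (Γ : Set (Fin n → ℝ)) : Prop :=
  ∃ R₀ > 0, RelativelyDenseWith Γ R₀

/-- Uniformly discrete with parameter `r₀`. -/
def UniformlyDiscreteWith {n : ℕ} (Γ : Set (Fin n → ℝ)) (r₀ : ℝ) : Prop :=
  ∀ x : Fin n → ℝ, ∀ r, 0 < r → r ≤ r₀ → (Metric.ball x r ∩ Γ).Subsingleton

def UniformlyDiscrete {n : ℕ} (Γ : Set (Fin n → ℝ)) : Prop :=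
  ∃ r₀ > 0, UniformlyDiscreteWith Γ r₀

def Delone {n : ℕ} (Γ : Set (Fin n → ℝ)) : Prop :=
  RelativelyDense Γ ∧ UniformlyDiscrete Γ

/-- The translateSet `Γ + v`. -/
def translateSet {n : ℕ} (Γ : Set (Fin n → ℝ)) (v : Fin n → ℝ) : Set (Fin n → ℝ) :=
  (· + v) '' Γ

/-- `N` is a set of `ε`-translations of `Γ` with radius `Rε`. -/
def IsEpsTranslationSet {n : ℕ} (Γ : Set (Fin n → ℝ)) (ε Rε : ℝ)
    (N : Set (Fin n → ℝ)) : Prop :=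
  N ⊆ intPoints n ∧ RelativelyDense N ∧
    ∀ R, Rε ≤ R → ∀ v ∈ N, DRplus (symmDiff (translateSet Γ v) Γ) R < ε

/-- Almost periodic pattern. -/
def AlmostPeriodicPattern {n : ℕ} (Γ : Set (Fin n → ℝ)) : Prop :=
  Γ ⊆ intPoints n ∧ Delone Γ ∧
    ∀ ε > 0, ∃ Rε > 0, ∃ N : Set (Fin n → ℝ), IsEpsTranslationSet Γ ε Rε N

/-- `Γ` has uniform density `D`. -/
def HasUnifDensity {n : ℕ} (Γ : Set (Fin n → ℝ)) (D : ℝ) : Prop :=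
  ∀ ε > 0, ∃ R₀ > 0, ∀ R, R₀ ≤ R → ∀ x : Fin n → ℝ,
    |((Metric.ball x R ∩ Γ).ncard : ℝ) / ((Metric.ball x R ∩ intPoints n).ncard : ℝ) - D| ≤ ε

/-- `Γ ∩ (Γ - v)`, the set of `x ∈ Γ` with `x + v ∈ Γ`. -/
def diffSet {n : ℕ} (Γ : Set (Fin n → ℝ)) (v : Fin n → ℝ) : Set (Fin n → ℝ) :=
  Γ ∩ {x | x + v ∈ Γ}

/-- `E` is equidistributed modulo `ℤ^n`: averages of continuous `ℤ^n`-periodic functions over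
`E ∩ B_R` converge to the Haar integral. -/
def EquidistributedModZn {n : ℕ} (E : Set (Fin n → ℝ)) : Prop :=
  ∀ f : (Fin n → ℝ) → ℝ, Continuous f →
    (∀ (x : Fin n → ℝ) (v : Fin n → ℤ), f (x + intVec v) = f x) →
    Filter.Tendsto (fun R : ℝ =>
        (∑ᶠ x ∈ E ∩ Metric.ball (0 : Fin n → ℝ) R, f x) /
          ((E ∩ Metric.ball (0 : Fin n → ℝ) R).ncard : ℝ))
      Filter.atTop
      (nhds (∫ x in Set.pi Set.univ (fun _ : Fin n => Set.Ico (0:ℝ) 1), f x))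

/-- `P` is totally irrational: `P(ℤ^n)` is equidistributed modulo `ℤ^n`. -/
def TotallyIrrational {n : ℕ} (P : Matrix (Fin n) (Fin n) ℝ) : Prop :=
  EquidistributedModZn (P.mulVec '' intPoints n)

/-- Rate of injectivity in time 1. -/
def tauOne {n : ℕ} (P : Matrix (Fin n) (Fin n) ℝ) : ℝ :=
  Filter.limsup (fun R : ℝ =>
    ((PhatImg P (intPoints n) ∩ Metric.ball (0 : Fin n → ℝ) R).ncard : ℝ) /
      ((intPoints n ∩ Metric.ball (0 : Fin n → ℝ) R).ncard : ℝ)) Filter.atTop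

/-- The successive images `(P̂_k ∘ ⋯ ∘ P̂_1)(Γ)`. -/
def seqImg {n : ℕ} (P : ℕ → Matrix (Fin n) (Fin n) ℝ) :
    ℕ → Set (Fin n → ℝ) → Set (Fin n → ℝ)
  | 0, Γ => Γ
  | k + 1, Γ => PhatImg (P (k + 1)) (seqImg P k Γ)

/-- Rate of injectivity in time `k` of the sequence `(P_k)`. -/
def tauK {n : ℕ} (P : ℕ → Matrix (Fin n) (Fin n) ℝ) (k : ℕ) : ℝ :=
  Filter.limsup (fun R : ℝ =>
    ((seqImg P k (intPoints n) ∩ Metric.ball (0 : Fin n → ℝ) R).ncard : ℝ) /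
      ((intPoints n ∩ Metric.ball (0 : Fin n → ℝ) R).ncard : ℝ)) Filter.atTop

/-- A fixed norm on `M_n(ℝ)`: the sup of absolute values of the entries. -/
def matNorm {n : ℕ} (A : Matrix (Fin n) (Fin n) ℝ) : ℝ :=
  ⨆ p : Fin n × Fin n, |A p.1 p.2|


/-- The function `φ_u`, a "weighted projection" of `u` on `ℤ^n`. -/
def phiFn {n : ℕ} (u : Fin n → ℝ) (v : Fin n → ℤ) : ℝ :=
  if ‖u - intVec v‖ < 1 then ∏ i, (1 - |u i - (v i : ℝ)|) else 0

/-- `I_ℚ(A)`: the set of indices `i` such that all entries of the `i`-th row of `A`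
are rational. -/
def IQ {n : ℕ} (A : Matrix (Fin n) (Fin n) ℝ) : Set (Fin n) :=
  {i | ∀ j, ∃ q : ℚ, A i j = (q : ℝ)}

/-- A sequence of matrices all lying in `O_n(ℝ)`. -/
def IsOnSeq {n : ℕ} (P : ℕ → Matrix (Fin n) (Fin n) ℝ) : Prop :=
  ∀ k, P k ∈ Matrix.orthogonalGroup (Fin n) ℝ

/-- The `ℓ^∞` distance on sequences of matrices. -/
def seqDist {n : ℕ} (P Q : ℕ → Matrix (Fin n) (Fin n) ℝ) : ℝ :=
  ⨆ k : ℕ, matNorm (P k - Q k)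

/-- Open subsets of `ℓ^∞(O_n(ℝ))`. -/
def IsOpenSeq {n : ℕ} (U : Set {P : ℕ → Matrix (Fin n) (Fin n) ℝ // IsOnSeq P}) : Prop :=
  ∀ P ∈ U, ∃ δ > 0, ∀ Q : {P : ℕ → Matrix (Fin n) (Fin n) ℝ // IsOnSeq P},
    seqDist P.1 Q.1 < δ → Q ∈ U

/-- Dense subsets of `ℓ^∞(O_n(ℝ))`. -/
def IsDenseSeq {n : ℕ} (U : Set {P : ℕ → Matrix (Fin n) (Fin n) ℝ // IsOnSeq P}) : Prop :=
  ∀ P : {P : ℕ → Matrix (Fin n) (Fin n) ℝ // IsOnSeq P}, ∀ δ > 0,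
    ∃ Q ∈ U, seqDist P.1 Q.1 < δ

/-- The unit cube `[0, 1)^n`. -/
def unitCube (n : ℕ) : Set (Fin n → ℝ) := Set.pi Set.univ (fun _ => Set.Ico (0 : ℝ) 1)

/-- A set invariant under integer translations. -/
def IntPeriodic {n : ℕ} (S : Set (Fin n → ℝ)) : Prop :=
  ∀ (x : Fin n → ℝ) (v : Fin n → ℤ), x + intVec v ∈ S ↔ x ∈ S

lemma IntPeriodic.image_add_right {n : ℕ} {S : Set (Fin n → ℝ)} (hS : IntPeriodic S)
    (v : Fin n → ℤ) : (fun y => y + intVec v) '' S = S := by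
  ext y
  constructor
  · rintro ⟨x, hx, rfl⟩
    exact (hS x v).2 hx
  · intro hy
    refine ⟨y - intVec v, ?_, by simp⟩
    rw [← hS _ v]
    simpa using hy

lemma IntPeriodic.compl {n : ℕ} {S : Set (Fin n → ℝ)} (hS : IntPeriodic S) : IntPeriodic Sᶜ :=
  fun x v => not_congr (hS x v)

lemma IntPeriodic.union {n : ℕ} {S T : Set (Fin n → ℝ)} (hS : IntPeriodic S)
    (hT : IntPeriodic T) : IntPeriodic (S ∪ T) :=
  fun x v => or_congr (hS x v) (hT x v)

lemma IntPeriodic.closure {n : ℕ} {S : Set (Fin n → ℝ)} (hS : IntPeriodic S) :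
    IntPeriodic (closure S) := by
  intro x v
  have h := (Homeomorph.addRight (intVec v)).image_closure S
  have h' : (Homeomorph.addRight (intVec v)) '' S = S := hS.image_add_right v
  rw [h'] at h
  constructor
  · intro hx
    rw [← h] at hx
    obtain ⟨y, hy, hyx⟩ := hx
    have : y = x := by simpa using hyx
    exact this ▸ hy
  · intro hx
    rw [← h]
    exact ⟨x, hx, rfl⟩

lemma IntPeriodic.infEDist_add {n : ℕ} {S : Set (Fin n → ℝ)} (hS : IntPeriodic S)
    (x : Fin n → ℝ) (v : Fin n → ℤ) :
    Metric.infEDist (x + intVec v) S = Metric.infEDist x S := by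
  have h := Metric.infEDist_image (x := x) (t := S) (isometry_add_right (intVec v))
  rwa [hS.image_add_right v] at h

lemma volume_unitCube (n : ℕ) : volume (unitCube n) = 1 := by
  rw [unitCube, Real.volume_pi_Ico (a := fun _ => 0) (b := fun _ => 1)]
  simp

instance isProbabilityMeasure_restrict_unitCube (n : ℕ) :
    IsProbabilityMeasure ((volume : Measure (Fin n → ℝ)).restrict (unitCube n)) :=
  ⟨by simp [volume_unitCube]⟩

lemma EquidistributedModZn.eventually_ncard_le_of_isClosed {n : ℕ} {E : Set (Fin n → ℝ)}
    (hE : EquidistributedModZn E) (hfin : ∀ R : ℝ, (E ∩ Metric.ball 0 R).Finite)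
    {K : Set (Fin n → ℝ)} (hK : IsClosed K) (hper : IntPeriodic K) {ε : ℝ} (hε : 0 < ε) :
    ∀ᶠ R : ℝ in atTop, ((E ∩ Metric.ball 0 R ∩ K).ncard : ℝ) / ((E ∩ Metric.ball 0 R).ncard : ℝ)
      < (volume.restrict (unitCube n)).real K + ε := by
  obtain ⟨k, hk⟩ := ((tendsto_integral_thickenedIndicator_of_isClosed
    (volume.restrict (unitCube n)) hK (δs := fun k : ℕ => 1 / ((k : ℝ) + 1))
    (fun k => by positivity) tendsto_one_div_add_atTop_nhds_zero_nat).eventually_lt_const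
    (lt_add_of_pos_right _ hε)).exists
  have hpos : (0 : ℝ) < 1 / ((k : ℝ) + 1) := by positivity
  have hlim := hE (fun x => (thickenedIndicator hpos K x : ℝ)) (by fun_prop) (by
    intro x v
    simp only [thickenedIndicator.coeFn_eq_comp, Function.comp_apply, thickenedIndicatorAux,
      hper.infEDist_add x v])
  filter_upwards [hlim.eventually_lt_const hk] with R hR
  refine lt_of_le_of_lt ?_ hR
  gcongr
  rw [finsum_mem_eq_finite_toFinset_sum _ (hfin R),
    Set.ncard_eq_toFinset_card _ ((hfin R).inter_of_left K), Finset.card_eq_sum_ones,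
    Nat.cast_sum]
  calc (∑ x ∈ ((hfin R).inter_of_left K).toFinset, ((1 : ℕ) : ℝ))
      ≤ ∑ x ∈ ((hfin R).inter_of_left K).toFinset, (thickenedIndicator hpos K x : ℝ) := by
        refine Finset.sum_le_sum fun x hx => ?_
        have hx' : x ∈ K := ((Set.Finite.mem_toFinset _).1 hx).2
        rw [thickenedIndicator_one hpos K hx']
        simp
    _ ≤ _ := by
        refine Finset.sum_le_sum_of_subset_of_nonneg ?_ fun _ _ _ => NNReal.coe_nonneg _
        intro x hx
        rw [Set.Finite.mem_toFinset] at hx ⊢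
        exact hx.1

lemma EquidistributedModZn.tendsto_ncard_div {n : ℕ} {E : Set (Fin n → ℝ)}
    (hE : EquidistributedModZn E) (hfin : ∀ R : ℝ, (E ∩ Metric.ball 0 R).Finite)
    {S : Set (Fin n → ℝ)} (hper : IntPeriodic S) (hfr : volume (frontier S) = 0) :
    Tendsto (fun R : ℝ => ((E ∩ Metric.ball 0 R ∩ S).ncard : ℝ) /
      ((E ∩ Metric.ball 0 R).ncard : ℝ)) atTop (nhds (volume.real (S ∩ unitCube n))) := by
  have hfr' : volume.restrict (unitCube n) (frontier S) = 0 :=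
    Measure.absolutelyContinuous_of_le Measure.restrict_le_self hfr
  have hcube : MeasurableSet (unitCube n) := MeasurableSet.univ_pi fun _ => measurableSet_Ico
  have hnull : NullMeasurableSet S (volume.restrict (unitCube n)) :=
    nullMeasurableSet_of_null_frontier hfr'
  have hval : volume.real (S ∩ unitCube n) = (volume.restrict (unitCube n)).real S := by
    simp only [measureReal_def, Measure.restrict_apply' hcube]
  have hcl : (volume.restrict (unitCube n)).real (closure S)
      = (volume.restrict (unitCube n)).real S := by
    simp only [measureReal_def, measure_closure_of_null_frontier hfr']
  have hcl' : (volume.restrict (unitCube n)).real (closure Sᶜ)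
      = 1 - (volume.restrict (unitCube n)).real S := by
    rw [← probReal_compl_eq_one_sub₀ hnull, measureReal_def, measureReal_def,
      measure_closure_of_null_frontier (by rwa [frontier_compl])]
  have hone : ∀ᶠ R : ℝ in atTop, ((E ∩ Metric.ball 0 R).ncard : ℝ) ≠ 0 := by
    have h := hE (fun _ => 1) continuous_const fun _ _ => rfl
    have h1 : ∫ x in Set.pi Set.univ (fun _ : Fin n => Set.Ico (0:ℝ) 1), (1 : ℝ) = 1 := by
      change ∫ x in unitCube n, (1 : ℝ) = 1
      simp
    rw [h1] at h
    filter_upwards [h.eventually_ne one_ne_zero] with R hR h0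
    simp [h0] at hR
  rw [hval, Metric.tendsto_nhds]
  intro ε hε
  filter_upwards [hone,
    hE.eventually_ncard_le_of_isClosed hfin isClosed_closure hper.closure hε,
    hE.eventually_ncard_le_of_isClosed hfin isClosed_closure hper.compl.closure hε]
    with R h0 h1 h2
  rw [hcl] at h1
  rw [hcl'] at h2
  have e1 : ((E ∩ Metric.ball 0 R ∩ S).ncard : ℝ) / ((E ∩ Metric.ball 0 R).ncard : ℝ) ≤
      ((E ∩ Metric.ball 0 R ∩ closure S).ncard : ℝ) / ((E ∩ Metric.ball 0 R).ncard : ℝ) := by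
    gcongr
    · exact (hfin R).inter_of_left _
    · exact subset_closure
  have e2 : ((E ∩ Metric.ball 0 R ∩ Sᶜ).ncard : ℝ) / ((E ∩ Metric.ball 0 R).ncard : ℝ) ≤
      ((E ∩ Metric.ball 0 R ∩ closure Sᶜ).ncard : ℝ) / ((E ∩ Metric.ball 0 R).ncard : ℝ) := by
    gcongr
    · exact (hfin R).inter_of_left _
    · exact subset_closure
  have e3 : ((E ∩ Metric.ball 0 R ∩ S).ncard : ℝ) / ((E ∩ Metric.ball 0 R).ncard : ℝ) +
      ((E ∩ Metric.ball 0 R ∩ Sᶜ).ncard : ℝ) / ((E ∩ Metric.ball 0 R).ncard : ℝ) = 1 := by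
    rw [← add_div, div_eq_one_iff_eq h0]
    exact_mod_cast Set.ncard_inter_add_ncard_sdiff_eq_ncard (E ∩ Metric.ball 0 R) S (hfin R)
  rw [Real.dist_eq, abs_lt]
  constructor <;> linarith

lemma roundHalf_add_intCast (x : ℝ) (k : ℤ) : roundHalf (x + k) = roundHalf x + k := by
  rw [roundHalf, roundHalf, add_sub_right_comm, Int.ceil_add_intCast]

lemma roundHalf_eq_iff {x : ℝ} {k : ℤ} : roundHalf x = k ↔ (k : ℝ) - 1 / 2 < x ∧ x ≤ k + 1 / 2 := by
  rw [roundHalf, Int.ceil_eq_iff]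
  constructor <;> rintro ⟨h1, h2⟩ <;> constructor <;> linarith

lemma roundHalf_bounds (x : ℝ) :
    (roundHalf x : ℝ) - 1 / 2 < x ∧ x ≤ (roundHalf x : ℝ) + 1 / 2 :=
  roundHalf_eq_iff.1 rfl

lemma eventually_roundHalf_eq {x : ℝ} (hx : ∀ k : ℤ, x ≠ k + 1 / 2) :
    ∀ᶠ y in nhds x, roundHalf y = roundHalf x := by
  obtain ⟨h1, h2⟩ := roundHalf_bounds x
  filter_upwards [Ioo_mem_nhds h1 (lt_of_le_of_ne h2 (hx _))] with y hy
  exact roundHalf_eq_iff.2 ⟨hy.1, hy.2.le⟩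

/-- The points whose translate by `d` is rounded to the same integer. -/
def sameRound (d : ℝ) : Set ℝ := {x | roundHalf (x + d) = roundHalf x}

lemma roundHalf_eq_zero {x : ℝ} (h0 : 0 ≤ x) (h1 : x ≤ 1 / 2) : roundHalf x = 0 :=
  roundHalf_eq_iff.2 ⟨by push_cast; linarith, by push_cast; linarith⟩

lemma roundHalf_eq_one {x : ℝ} (h0 : 1 / 2 < x) (h1 : x < 1) : roundHalf x = 1 :=
  roundHalf_eq_iff.2 ⟨by push_cast; linarith, by push_cast; linarith⟩

lemma mem_sameRound_inter_Ico {d x : ℝ} : x ∈ sameRound d ∩ Set.Ico 0 1 ↔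
    (0 ≤ x ∧ x ≤ 1 / 2 ∧ -(1 / 2) < x + d ∧ x + d ≤ 1 / 2) ∨
    (1 / 2 < x ∧ x < 1 ∧ 1 / 2 < x + d ∧ x + d ≤ 3 / 2) := by
  simp only [sameRound, Set.mem_inter_iff, Set.mem_ofPred_eq, Set.mem_Ico]
  constructor
  · rintro ⟨h, h0, h1⟩
    rcases le_or_gt x (1 / 2) with hx | hx
    · rw [roundHalf_eq_zero h0 hx, roundHalf_eq_iff] at h
      push_cast at h
      exact Or.inl ⟨h0, hx, by linarith, by linarith⟩
    · rw [roundHalf_eq_one hx h1, roundHalf_eq_iff] at h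
      push_cast at h
      exact Or.inr ⟨hx, h1, by linarith, by linarith⟩
  · rintro (⟨h0, h1, h2, h3⟩ | ⟨h0, h1, h2, h3⟩)
    · refine ⟨?_, h0, by linarith⟩
      rw [roundHalf_eq_zero h0 h1, roundHalf_eq_iff]
      push_cast
      constructor <;> linarith
    · refine ⟨?_, by linarith, h1⟩
      rw [roundHalf_eq_one h0 h1, roundHalf_eq_iff]
      push_cast
      constructor <;> linarith

lemma volume_sameRound_inter_Ico {d : ℝ} (hd : |d| < 1) :
    volume (sameRound d ∩ Set.Ico 0 1) = ENNReal.ofReal (1 - |d|) := by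
  obtain ⟨hd1, hd2⟩ := abs_lt.1 hd
  rcases le_or_gt 0 d with h | h
  · rw [abs_of_nonneg h]
    rcases le_or_gt d (1 / 2) with h' | h'
    · have : sameRound d ∩ Set.Ico 0 1 = Set.Icc 0 (1 / 2 - d) ∪ Set.Ioo (1 / 2) 1 := by
        ext x
        rw [mem_sameRound_inter_Ico, Set.mem_union, Set.mem_Icc, Set.mem_Ioo]
        refine or_congr ⟨?_, ?_⟩ ⟨?_, ?_⟩ <;> intro hx <;> refine ⟨?_, ?_⟩ <;> grind
      rw [this, measure_union (Set.disjoint_left.2 fun x hx hx' => by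
          have := hx.2
          have := hx'.1
          linarith) measurableSet_Ioo, Real.volume_Icc, Real.volume_Ioo,
        ← ENNReal.ofReal_add (by linarith) (by norm_num)]
      congr 1
      ring
    · have : sameRound d ∩ Set.Ico 0 1 = Set.Ioc (1 / 2) (3 / 2 - d) := by
        ext x
        rw [mem_sameRound_inter_Ico, Set.mem_Ioc]
        grind
      rw [this, Real.volume_Ioc]
      congr 1
      ring
  · rw [abs_of_neg h]
    rcases le_or_gt d (-(1 / 2)) with h' | h'
    · have : sameRound d ∩ Set.Ico 0 1 = Set.Ioc (-(1 / 2) - d) (1 / 2) := by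
        ext x
        rw [mem_sameRound_inter_Ico, Set.mem_Ioc]
        grind
      rw [this, Real.volume_Ioc]
      congr 1
      ring
    · have : sameRound d ∩ Set.Ico 0 1 = Set.Icc 0 (1 / 2) ∪ Set.Ioo (1 / 2 - d) 1 := by
        ext x
        rw [mem_sameRound_inter_Ico, Set.mem_union, Set.mem_Icc, Set.mem_Ioo]
        refine or_congr ⟨?_, ?_⟩ ⟨?_, ?_⟩ <;> intro hx <;> refine ⟨?_, ?_⟩ <;> grind
      rw [this, measure_union (Set.disjoint_left.2 fun x hx hx' => by
          have := hx.2
          have := hx'.1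
          linarith) measurableSet_Ioo, Real.volume_Icc, Real.volume_Ioo,
        ← ENNReal.ofReal_add (by linarith) (by linarith)]
      congr 1
      ring

/-- The points whose translate by `a` has the same discretization. -/
def sameCell {n : ℕ} (a : Fin n → ℝ) : Set (Fin n → ℝ) :=
  {u | discretize (u + a) = discretize u}

lemma discretize_add_intVec {n : ℕ} (x : Fin n → ℝ) (v : Fin n → ℤ) :
    discretize (x + intVec v) = discretize x + v :=
  funext fun i => roundHalf_add_intCast (x i) (v i)

lemma intPeriodic_sameCell {n : ℕ} (a : Fin n → ℝ) : IntPeriodic (sameCell a) := by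
  intro x v
  simp only [sameCell, Set.mem_ofPred_eq]
  rw [add_right_comm, discretize_add_intVec, discretize_add_intVec, add_left_inj]

lemma volume_frontier_sameCell {n : ℕ} (a : Fin n → ℝ) : volume (frontier (sameCell a)) = 0 := by
  have hsub : frontier (sameCell a) ⊆
      ⋃ (i : Fin n) (k : ℤ), ({u | u i = k + 1 / 2} ∪ {u | u i = k + 1 / 2 - a i}) := by
    intro u hu
    by_contra hcon
    simp only [Set.mem_iUnion, Set.mem_union, Set.mem_ofPred_eq, not_exists, not_or] at hcon
    have h1 : ∀ᶠ y in nhds u, ∀ i, roundHalf (y i) = roundHalf (u i) :=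
      eventually_all.2 fun i =>
        (continuous_apply i).continuousAt.eventually
          (eventually_roundHalf_eq (x := u i) fun k => (hcon i k).1)
    have h2 : ∀ᶠ y in nhds u, ∀ i, roundHalf (y i + a i) = roundHalf (u i + a i) := by
      refine eventually_all.2 fun i => ?_
      have hc : ContinuousAt (fun y : Fin n → ℝ => y i + a i) u :=
        ((continuous_apply i).add continuous_const).continuousAt
      refine hc.eventually (eventually_roundHalf_eq (x := u i + a i) fun k hk => (hcon i k).2 ?_)
      linarith
    have h3 : ∀ᶠ y in nhds u, (y ∈ sameCell a ↔ u ∈ sameCell a) := by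
      filter_upwards [h1, h2] with y hy1 hy2
      simp only [sameCell, Set.mem_ofPred_eq, discretize, funext_iff, Pi.add_apply, hy1, hy2]
    rw [frontier_eq_closure_inter_closure] at hu
    obtain ⟨y, hy, hyS⟩ := ((mem_closure_iff_frequently.1 hu.1).and_eventually h3).exists
    obtain ⟨z, hz, hzS⟩ := ((mem_closure_iff_frequently.1 hu.2).and_eventually h3).exists
    exact hz (hzS.2 (hyS.1 hy))
  refine measure_mono_null hsub ?_
  refine measure_iUnion_null fun i => measure_iUnion_null fun k => measure_union_null ?_ ?_
  · exact Measure.pi_hyperplane (fun _ => volume) i _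
  · exact Measure.pi_hyperplane (fun _ => volume) i _

lemma volume_sameCell_inter_unitCube {n : ℕ} {a : Fin n → ℝ} (ha : ∀ i, |a i| < 1) :
    volume (sameCell a ∩ unitCube n) = ENNReal.ofReal (∏ i, (1 - |a i|)) := by
  have : sameCell a ∩ unitCube n = Set.pi Set.univ fun i => sameRound (a i) ∩ Set.Ico 0 1 := by
    ext u
    simp only [sameCell, unitCube, sameRound, discretize, funext_iff, Set.mem_inter_iff,
      Set.mem_ofPred_eq, Set.mem_univ_pi, Pi.add_apply, forall_and]
  rw [this, volume_pi_pi, ENNReal.ofReal_prod_of_nonneg fun i _ => sub_nonneg.2 (ha i).le]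
  exact Finset.prod_congr rfl fun i _ => volume_sameRound_inter_Ico (ha i)

lemma mem_span_basisFun_iff {n : ℕ} {x : Fin n → ℝ} :
    x ∈ Submodule.span ℤ (Set.range (Pi.basisFun ℝ (Fin n))) ↔ x ∈ intPoints n := by
  rw [Module.Basis.mem_span_iff_repr_mem]
  simp only [Pi.basisFun_repr, intPoints, Set.mem_range, algebraMap_int_eq, eq_intCast]
  constructor
  · intro h
    choose v hv using h
    exact ⟨v, funext hv⟩
  · rintro ⟨v, rfl⟩ i
    exact ⟨v i, rfl⟩

lemma isBounded_mulVec_preimage_ball {n : ℕ} {M : Matrix (Fin n) (Fin n) ℝ} (hM : IsUnit M.det)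
    (R : ℝ) : Bornology.IsBounded (M.mulVecLin ⁻¹' Metric.ball 0 R) := by
  refine ((isCompact_closedBall (0 : Fin n → ℝ) R).image
    (M⁻¹.mulVecLin.continuous_of_finiteDimensional)).isBounded.subset ?_
  intro x hx
  refine ⟨M.mulVec x, Metric.ball_subset_closedBall hx, ?_⟩
  simp [Matrix.mulVec_mulVec, Matrix.nonsing_inv_mul M hM]

lemma finite_image_intPoints_inter_ball {n : ℕ} {M : Matrix (Fin n) (Fin n) ℝ}
    (hM : IsUnit M.det) (R : ℝ) : (M.mulVec '' intPoints n ∩ Metric.ball 0 R).Finite := by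
  have h := ZSpan.setFinite_inter (Pi.basisFun ℝ (Fin n)) (isBounded_mulVec_preimage_ball hM R)
  refine (h.image M.mulVec).subset ?_
  rintro _ ⟨⟨x, hx, rfl⟩, hR⟩
  exact ⟨x, ⟨hR, mem_span_basisFun_iff.2 hx⟩, rfl⟩

lemma tendsto_ncard_image_intPoints_inter_ball {n : ℕ} {M : Matrix (Fin n) (Fin n) ℝ}
    (hM : |M.det| = 1) :
    Tendsto (fun R : ℝ => ((M.mulVec '' intPoints n ∩ Metric.ball 0 R).ncard : ℝ) / R ^ n)
      atTop (nhds (2 ^ n)) := by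
  have hdet : M.det ≠ 0 := fun h => by simp [h] at hM
  have hunit : IsUnit M.det := isUnit_iff_ne_zero.2 hdet
  have hinj : Function.Injective M.mulVec := Matrix.mulVec_injective_of_isUnit
    ((Matrix.isUnit_iff_isUnit_det M).2 hunit)
  have hconv : Convex ℝ (M.mulVecLin ⁻¹' Metric.ball (0 : Fin n → ℝ) 1) :=
    (convex_ball 0 1).linear_preimage _
  have hlim := tendsto_card_div_pow_atTop_volume' (M.mulVecLin ⁻¹' Metric.ball (0 : Fin n → ℝ) 1)
    (isBounded_mulVec_preimage_ball hunit 1)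
    (measurableSet_ball.preimage M.mulVecLin.continuous_of_finiteDimensional.measurable)
    (hconv.addHaar_frontier volume) (by
      rintro x y hx hxy _ ⟨z, hz, rfl⟩
      have hy : 0 < y := hx.trans_le hxy
      refine ⟨(x / y) • z, ?_, ?_⟩
      · simp only [Set.mem_preimage, mem_ball_zero_iff, map_smul, norm_smul] at hz ⊢
        have h1 : ‖x / y‖ ≤ 1 := by
          rw [Real.norm_of_nonneg (by positivity)]
          exact (div_le_one hy).2 hxy
        calc ‖x / y‖ * ‖M.mulVecLin z‖ ≤ 1 * ‖M.mulVecLin z‖ := by gcongr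
          _ < 1 := by simpa using hz
      · simp only [smul_smul]
        rw [mul_div_cancel₀ _ hy.ne'])
  have hdet' : LinearMap.det M.mulVecLin = M.det := LinearMap.det_toLin' M
  have hvol : volume.real (M.mulVecLin ⁻¹' Metric.ball (0 : Fin n → ℝ) 1) = 2 ^ n := by
    rw [measureReal_def, Measure.addHaar_preimage_linearMap volume (by rwa [hdet']),
      Real.volume_pi_ball _ one_pos, hdet']
    simp [abs_inv, hM]
  rw [hvol] at hlim
  refine hlim.congr' ?_
  filter_upwards [eventually_gt_atTop 0] with R hR
  rw [Fintype.card_fin, Nat.card_coe_set_eq]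
  congr 2
  refine Set.ncard_congr (fun x _ => M.mulVec (R • x)) ?_ ?_ ?_
  · rintro _ ⟨hx, y, hy, rfl⟩
    simp only [smul_smul, mul_inv_cancel₀ hR.ne', one_smul]
    refine ⟨⟨y, mem_span_basisFun_iff.1 hy, rfl⟩, ?_⟩
    simp only [Set.mem_preimage, mem_ball_zero_iff, map_smul, norm_smul, norm_inv,
      Real.norm_of_nonneg hR.le, inv_mul_lt_iff₀ hR, mul_one] at hx
    simpa using hx
  · intro x y _ _ h
    exact smul_right_injective _ hR.ne' (hinj h)
  · rintro _ ⟨⟨y, hy, rfl⟩, hR'⟩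
    refine ⟨R⁻¹ • y, ⟨?_, y, mem_span_basisFun_iff.2 hy, rfl⟩, ?_⟩
    · simp only [Set.mem_preimage, mem_ball_zero_iff, map_smul, norm_smul, norm_inv,
        Real.norm_of_nonneg hR.le, inv_mul_lt_iff₀ hR, mul_one]
      simpa using hR'
    · simp only [smul_smul, mul_inv_cancel₀ hR.ne', one_smul]

lemma intVec_injective {n : ℕ} : Function.Injective (intVec (n := n)) := fun _ _ h =>
  funext fun i => Int.cast_injective (congrFun h i)

lemma abs_sub_lt_one_of_discretize_eq {n : ℕ} {x y : Fin n → ℝ}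
    (h : discretize x = discretize y) (i : Fin n) : |x i - y i| < 1 := by
  have h' : roundHalf (x i) = roundHalf (y i) := congrFun h i
  have hx := roundHalf_bounds (x i)
  have hy := roundHalf_bounds (y i)
  rw [h'] at hx
  rw [abs_lt]
  constructor <;> linarith

lemma norm_discretizeR_sub_le {n : ℕ} (x : Fin n → ℝ) : ‖discretizeR x - x‖ ≤ 1 := by
  refine (pi_norm_le_iff_of_nonneg zero_le_one).2 fun i => ?_
  have hx := roundHalf_bounds (x i)
  change |(roundHalf (x i) : ℝ) - x i| ≤ 1
  rw [abs_le]
  constructor <;> linarith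

/-- If `discretizeR` maps `E ∩ S` bijectively onto its image of `E`, and `E ∩ S` has
asymptotic density `δ`, so has this image. -/
lemma tendsto_ncard_discretizeR_image {n : ℕ} {E S : Set (Fin n → ℝ)} {δ : ℝ}
    (hfin : ∀ R : ℝ, (E ∩ Metric.ball 0 R).Finite)
    (hinj : Set.InjOn discretizeR (E ∩ S))
    (himg : discretizeR '' (E ∩ S) = discretizeR '' E)
    (hlim : Tendsto (fun R : ℝ => ((E ∩ Metric.ball 0 R ∩ S).ncard : ℝ) / R ^ n) atTop (nhds δ)) :
    Tendsto (fun R : ℝ => ((discretizeR '' E ∩ Metric.ball 0 R).ncard : ℝ) / R ^ n) atTop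
      (nhds δ) := by
  have hcard (R : ℝ) : (discretizeR '' E ∩ Metric.ball 0 R).ncard
      = (E ∩ S ∩ discretizeR ⁻¹' Metric.ball 0 R).ncard := by
    rw [← himg, ← Set.image_inter_preimage, (hinj.mono Set.inter_subset_left).ncard_image]
  have hshift (t : ℝ) : Tendsto (fun R : ℝ =>
      ((E ∩ Metric.ball 0 (R + t) ∩ S).ncard : ℝ) / R ^ n) atTop (nhds δ) := by
    have h1 : Tendsto (fun R : ℝ => ((R + t) / R) ^ n) atTop (nhds 1) := by
      have : Tendsto (fun R : ℝ => 1 + t / R) atTop (nhds (1 + 0)) :=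
        tendsto_const_nhds.add (tendsto_const_nhds.div_atTop tendsto_id)
      have h2 := (this.congr' (f₂ := fun R : ℝ => (R + t) / R) (by
        filter_upwards [eventually_ne_atTop 0] with R hR
        rw [add_div, div_self hR])).pow n
      simpa using h2
    have h2 := (hlim.comp (tendsto_atTop_add_const_right atTop t tendsto_id)).mul h1
    rw [mul_one] at h2
    refine h2.congr' ?_
    filter_upwards [eventually_gt_atTop 0, eventually_gt_atTop (-t)] with R hR hRt
    have : R + t ≠ 0 := by linarith
    simp only [Function.comp_apply, id]
    rw [div_pow]
    field_simp
  have hball (R : ℝ) {x : Fin n → ℝ} (hxR : x ∈ discretizeR ⁻¹' Metric.ball 0 R) :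
      x ∈ Metric.ball (0 : Fin n → ℝ) (R + 1) := by
    rw [Set.mem_preimage, mem_ball_zero_iff] at hxR
    rw [mem_ball_zero_iff]
    have := norm_discretizeR_sub_le x
    have := norm_sub_norm_le x (discretizeR x)
    rw [norm_sub_rev] at this
    linarith
  refine tendsto_of_tendsto_of_tendsto_of_le_of_le' (hshift (-1)) (hshift 1) ?_ ?_
  · filter_upwards [eventually_gt_atTop 0] with R hR
    rw [hcard]
    refine div_le_div_of_nonneg_right (Nat.cast_le.2 (Set.ncard_le_ncard ?_ ?_)) (by positivity)
    · rintro x ⟨⟨hx, hxR⟩, hxS⟩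
      refine ⟨⟨hx, hxS⟩, ?_⟩
      rw [mem_ball_zero_iff] at hxR
      rw [Set.mem_preimage, mem_ball_zero_iff]
      have := norm_discretizeR_sub_le x
      have := norm_sub_norm_le (discretizeR x) x
      linarith
    · refine (hfin (R + 1)).subset ?_
      rintro x ⟨⟨hx, -⟩, hxR⟩
      exact ⟨hx, hball R hxR⟩
  · filter_upwards [eventually_gt_atTop 0] with R hR
    rw [hcard]
    refine div_le_div_of_nonneg_right (Nat.cast_le.2 (Set.ncard_le_ncard ?_ ?_)) (by positivity)
    · rintro x ⟨⟨hx, hxS⟩, hxR⟩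
      exact ⟨⟨hx, hball R hxR⟩, hxS⟩
    · exact (hfin (R + 1)).inter_of_left S

/-- The points which share their cell neither with their translate by `(c, s)` nor with their
translate by `(-s, c)`. -/
def lastInCell (c s : ℝ) : Set (Fin 2 → ℝ) := (sameCell ![c, s] ∪ sameCell ![-s, c])ᶜ

lemma notMem_sameCell {n : ℕ} {a u : Fin n → ℝ} {i : Fin n} (h : 1 ≤ |a i|) :
    u ∉ sameCell a := fun hu => by
  have := abs_sub_lt_one_of_discretize_eq (hu : discretize (u + a) = discretize u) i
  rw [Pi.add_apply, add_sub_cancel_left] at this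
  exact absurd this (not_lt.2 h)

lemma sameCell_comp {n : ℕ} {a b u : Fin n → ℝ} (ha : u ∈ sameCell a)
    (hb : u + a ∈ sameCell b) : u ∈ sameCell (a + b) := by
  simp only [sameCell, Set.mem_ofPred_eq] at *
  rw [← add_assoc, hb, ha]

lemma disjoint_sameCell {c s : ℝ} (hcs : 1 ≤ c + s) :
    Disjoint (sameCell ![c, s]) (sameCell ![-s, c]) := by
  refine Set.disjoint_left.2 fun u hu hv => ?_
  have h : discretize (u + ![c, s]) = discretize (u + ![-s, c]) := Eq.trans hu (Eq.symm hv)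
  have := (abs_lt.1 (abs_sub_lt_one_of_discretize_eq h 0)).2
  simp at this
  linarith

lemma add_mem_lastInCell_left {c s : ℝ} (hcs : 1 ≤ c + s) {u : Fin 2 → ℝ} (hu : u ∈ sameCell ![c, s]) :
    u + ![c, s] ∈ lastInCell c s := by
  rintro (h | h)
  · have h2 := sameCell_comp hu h
    rcases le_total (1 / 2) c with hh | hh
    · exact notMem_sameCell (i := 0) (le_trans (by simp; linarith) (le_abs_self _)) h2
    · exact notMem_sameCell (i := 1) (le_trans (by simp; linarith) (le_abs_self _)) h2
  · exact notMem_sameCell (i := 1) (le_trans (by simp; linarith) (le_abs_self _))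
      (sameCell_comp hu h)

lemma add_mem_lastInCell_right {c s : ℝ} (hcs : 1 ≤ c + s) {u : Fin 2 → ℝ} (hu : u ∈ sameCell ![-s, c]) :
    u + ![-s, c] ∈ lastInCell c s := by
  rintro (h | h)
  · exact notMem_sameCell (i := 1) (le_trans (by simp; linarith) (le_abs_self _))
      (sameCell_comp hu h)
  · have h2 := sameCell_comp hu h
    rcases le_total (1 / 2) c with hh | hh
    · exact notMem_sameCell (i := 1) (le_trans (by simp; linarith) (le_abs_self _)) h2
    · exact notMem_sameCell (i := 0) (le_trans (by simp; linarith) (neg_le_abs _)) h2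

/-- The rotation matrix with cosine `c` and sine `s`. -/
abbrev rotMatrix (c s : ℝ) : Matrix (Fin 2) (Fin 2) ℝ := !![c, -s; s, c]

lemma rotMatrix_mulVec_intVec (c s : ℝ) (v : Fin 2 → ℤ) :
    (rotMatrix c s).mulVec (intVec v) = ![c * v 0 - s * v 1, s * v 0 + c * v 1] := by
  ext i
  fin_cases i <;> simp [Matrix.mulVec, dotProduct, Fin.sum_univ_two, intVec, sub_eq_add_neg]

lemma discretizeR_image_inter_lastInCell {c s : ℝ} (hcs : 1 ≤ c + s) :
    discretizeR '' ((rotMatrix c s).mulVec '' intPoints 2 ∩ lastInCell c s)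
      = discretizeR '' ((rotMatrix c s).mulVec '' intPoints 2) := by
  refine Set.Subset.antisymm (Set.image_mono Set.inter_subset_left) ?_
  rintro _ ⟨_, ⟨_, ⟨v, rfl⟩, rfl⟩, rfl⟩
  by_cases hA : (rotMatrix c s).mulVec (intVec v) ∈ sameCell ![c, s]
  · refine ⟨_, ⟨⟨intVec (v + ![1, 0]), ⟨_, rfl⟩, ?_⟩, add_mem_lastInCell_left hcs hA⟩,
      congrArg intVec hA⟩
    simp only [rotMatrix_mulVec_intVec]
    ext i
    fin_cases i <;> simp <;> ring
  by_cases hB : (rotMatrix c s).mulVec (intVec v) ∈ sameCell ![-s, c]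
  · refine ⟨_, ⟨⟨intVec (v + ![0, 1]), ⟨_, rfl⟩, ?_⟩, add_mem_lastInCell_right hcs hB⟩,
      congrArg intVec hB⟩
    simp only [rotMatrix_mulVec_intVec]
    ext i
    fin_cases i <;> simp <;> ring
  exact ⟨_, ⟨⟨_, ⟨v, rfl⟩, rfl⟩, fun h => h.elim hA hB⟩, rfl⟩

/-- An integer vector of squared length less than `2` is zero or a unit vector. -/
lemma int_pair_of_sq_add_sq_lt_two {m n : ℤ} (h : m ^ 2 + n ^ 2 < 2) :
    (m = 0 ∧ n = 0) ∨ (m = 1 ∧ n = 0) ∨ (m = -1 ∧ n = 0) ∨ (m = 0 ∧ n = 1) ∨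
      (m = 0 ∧ n = -1) := by
  have hm : m ≤ 1 := by nlinarith [sq_nonneg n]
  have hm' : -1 ≤ m := by nlinarith [sq_nonneg n]
  have hn : n ≤ 1 := by nlinarith [sq_nonneg m]
  have hn' : -1 ≤ n := by nlinarith [sq_nonneg m]
  interval_cases m <;> interval_cases n <;> simp_all

lemma injOn_discretizeR_lastInCell {c s : ℝ} (h1 : c ^ 2 + s ^ 2 = 1) :
    Set.InjOn discretizeR ((rotMatrix c s).mulVec '' intPoints 2 ∩ lastInCell c s) := by
  rintro _ ⟨⟨_, ⟨v, rfl⟩, rfl⟩, hv⟩ _ ⟨⟨_, ⟨w, rfl⟩, rfl⟩, hw⟩ h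
  have hd := intVec_injective h
  have h0 := abs_sub_lt_one_of_discretize_eq hd 0
  have h0' := abs_sub_lt_one_of_discretize_eq hd 1
  rw [lastInCell, Set.mem_compl_iff, Set.mem_union, not_or] at hv hw
  simp only [sameCell, Set.mem_ofPred_eq] at hv hw
  rw [hd] at hv
  rw [← hd] at hw
  simp only [rotMatrix_mulVec_intVec, Matrix.cons_val_zero, Matrix.cons_val_one] at *
  rw [← sq_lt_one_iff_abs_lt_one] at h0 h0'
  have hlt : (v 0 - w 0) ^ 2 + (v 1 - w 1) ^ 2 < 2 := by
    have : ((v 0 : ℝ) - w 0) ^ 2 + ((v 1 : ℝ) - w 1) ^ 2 < 2 := by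
      have e : ((v 0 : ℝ) - w 0) ^ 2 + ((v 1 : ℝ) - w 1) ^ 2 =
          (c ^ 2 + s ^ 2) * (((v 0 : ℝ) - w 0) ^ 2 + ((v 1 : ℝ) - w 1) ^ 2) := by
        rw [h1, one_mul]
      rw [e]
      linarith
    exact_mod_cast this
  rcases int_pair_of_sq_add_sq_lt_two hlt with ⟨e, e'⟩ | ⟨e, e'⟩ | ⟨e, e'⟩ | ⟨e, e'⟩ | ⟨e, e'⟩
  · rw [sub_eq_zero.1 e, sub_eq_zero.1 e']
  · refine absurd (congrArg discretize ?_) hw.1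
    rw [sub_eq_iff_eq_add.1 e, sub_eq_iff_eq_add.1 e']
    ext i
    fin_cases i <;> simp <;> ring
  · refine absurd (congrArg discretize ?_) hv.1
    rw [sub_eq_iff_eq_add.1 e, sub_eq_iff_eq_add.1 e']
    ext i
    fin_cases i <;> simp <;> ring
  · refine absurd (congrArg discretize ?_) hw.2
    rw [sub_eq_iff_eq_add.1 e, sub_eq_iff_eq_add.1 e']
    ext i
    fin_cases i <;> simp <;> ring
  · refine absurd (congrArg discretize ?_) hv.2
    rw [sub_eq_iff_eq_add.1 e, sub_eq_iff_eq_add.1 e']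
    ext i
    fin_cases i <;> simp <;> ring

lemma volume_lastInCell_inter_unitCube {c s : ℝ} (hc : 0 < c) (hs : 0 < s) (hc1 : c < 1)
    (hs1 : s < 1) (hcs : 1 ≤ c + s) :
    volume.real (lastInCell c s ∩ unitCube 2) = 1 - 2 * ((1 - c) * (1 - s)) := by
  have hA : volume (sameCell ![c, s] ∩ unitCube 2) = ENNReal.ofReal ((1 - c) * (1 - s)) := by
    rw [volume_sameCell_inter_unitCube]
    · simp [Fin.prod_univ_two, abs_of_pos hc, abs_of_pos hs]
    · intro i
      fin_cases i <;> simp [abs_of_pos hc, abs_of_pos hs, hc1, hs1]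
  have hB : volume (sameCell ![-s, c] ∩ unitCube 2) = ENNReal.ofReal ((1 - c) * (1 - s)) := by
    rw [volume_sameCell_inter_unitCube]
    · simp [Fin.prod_univ_two, abs_of_pos hc, abs_of_pos hs, mul_comm]
    · intro i
      fin_cases i <;> simp [abs_of_pos hc, abs_of_pos hs, hc1, hs1]
  have hcube : MeasurableSet (unitCube 2) := MeasurableSet.univ_pi fun _ => measurableSet_Ico
  have hnn : 0 ≤ (1 - c) * (1 - s) := mul_nonneg (by linarith) (by linarith)
  have hnull (a : Fin 2 → ℝ) : NullMeasurableSet (sameCell a) (volume.restrict (unitCube 2)) :=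
    nullMeasurableSet_of_null_frontier
      (Measure.absolutelyContinuous_of_le Measure.restrict_le_self (volume_frontier_sameCell a))
  rw [measureReal_def, ← Measure.restrict_apply' hcube, ← measureReal_def, lastInCell,
    probReal_compl_eq_one_sub₀ ((hnull _).union (hnull _)), measureReal_def,
    measure_union₀ (hnull _) (disjoint_sameCell hcs).aedisjoint, Measure.restrict_apply' hcube,
    Measure.restrict_apply' hcube, hA, hB, ← ENNReal.ofReal_add hnn hnn,
    ENNReal.toReal_ofReal (by linarith)]
  ring

lemma tauOne_rotMatrix {c s : ℝ} (hc : 0 < c) (hs : 0 < s) (h1 : c ^ 2 + s ^ 2 = 1)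
    (hirr : TotallyIrrational (rotMatrix c s)) :
    tauOne (rotMatrix c s) = 1 - 2 * ((1 - c) * (1 - s)) := by
  have hc1 : c < 1 := by nlinarith
  have hs1 : s < 1 := by nlinarith
  have hcs : 1 ≤ c + s := by nlinarith
  have hdet : (rotMatrix c s).det = 1 := by
    rw [Matrix.det_fin_two_of]
    linarith
  have hunit : IsUnit (rotMatrix c s).det := by
    rw [hdet]
    exact isUnit_one
  have hfin := finite_image_intPoints_inter_ball hunit
  have hper : IntPeriodic (lastInCell c s) :=
    ((intPeriodic_sameCell _).union (intPeriodic_sameCell _)).compl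
  have hfr : volume (frontier (lastInCell c s)) = 0 := by
    rw [lastInCell, frontier_compl]
    refine measure_mono_null (frontier_union_subset _ _) (measure_union_null
      (measure_mono_null Set.inter_subset_left (volume_frontier_sameCell _))
      (measure_mono_null Set.inter_subset_right (volume_frontier_sameCell _)))
  have hN := tendsto_ncard_image_intPoints_inter_ball (M := rotMatrix c s) (by simp [hdet])
  have hS := EquidistributedModZn.tendsto_ncard_div hirr hfin hper hfr
  rw [volume_lastInCell_inter_unitCube hc hs hc1 hs1 hcs] at hS
  have hSN := (hS.mul hN).congr' (f₂ := fun R : ℝ =>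
      (((rotMatrix c s).mulVec '' intPoints 2 ∩ Metric.ball 0 R ∩ lastInCell c s).ncard : ℝ)
        / R ^ 2) (by
    filter_upwards with R
    rcases eq_or_ne ((rotMatrix c s).mulVec '' intPoints 2 ∩ Metric.ball 0 R).ncard 0 with h | h
    · have h' : ((rotMatrix c s).mulVec '' intPoints 2 ∩ Metric.ball 0 R ∩
          lastInCell c s).ncard = 0 :=
        Nat.le_zero.1 (h ▸ Set.ncard_le_ncard Set.inter_subset_left (hfin R))
      rw [h, h', Nat.cast_zero, zero_div, zero_div, zero_mul]
    · have h' : (((rotMatrix c s).mulVec '' intPoints 2 ∩ Metric.ball 0 R).ncard : ℝ) ≠ 0 := by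
        exact_mod_cast h
      rw [div_mul_div_cancel₀ h'])
  have hI := tendsto_ncard_discretizeR_image hfin (injOn_discretizeR_lastInCell h1)
    (discretizeR_image_inter_lastInCell hcs) hSN
  have hZ := tendsto_ncard_image_intPoints_inter_ball (n := 2) (M := 1) (by simp)
  have hlim := (hI.div hZ (by norm_num)).congr' (f₂ := fun R : ℝ =>
    ((PhatImg (rotMatrix c s) (intPoints 2) ∩ Metric.ball (0 : Fin 2 → ℝ) R).ncard : ℝ) /
      ((intPoints 2 ∩ Metric.ball (0 : Fin 2 → ℝ) R).ncard : ℝ)) (by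
    filter_upwards [eventually_ne_atTop 0] with R hR
    have e1 : (1 : Matrix (Fin 2) (Fin 2) ℝ).mulVec '' intPoints 2 = intPoints 2 := by
      simp
    have e2 : PhatImg (rotMatrix c s) (intPoints 2)
        = discretizeR '' ((rotMatrix c s).mulVec '' intPoints 2) := by
      rw [Set.image_image]
      rfl
    simp only [Pi.div_apply]
    rw [e1, e2, div_div_div_cancel_right₀ (pow_ne_zero 2 hR)])
  rw [mul_div_cancel_right₀ _ (by norm_num)] at hlim
  exact hlim.limsup_eq

/-- The rate of injectivity in time 1 of a totally irrational rotation of angle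
`θ ∈ (0, π/2)` is `1 - (cos θ + sin θ - 1)²`. -/
theorem statement9 (θ : ℝ) (hθ₁ : 0 < θ) (hθ₂ : θ < Real.pi / 2)
    (hirr : TotallyIrrational !![Real.cos θ, -Real.sin θ; Real.sin θ, Real.cos θ]) :
    tauOne !![Real.cos θ, -Real.sin θ; Real.sin θ, Real.cos θ]
      = 1 - (Real.cos θ + Real.sin θ - 1) ^ 2 := by
  have hc : 0 < Real.cos θ := Real.cos_pos_of_mem_Ioo ⟨by linarith, hθ₂⟩
  have hs : 0 < Real.sin θ := Real.sin_pos_of_pos_of_lt_pi hθ₁ (by linarith)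
  have h1 := Real.cos_sq_add_sin_sq θ
  rw [tauOne_rotMatrix hc hs h1 hirr]
  linear_combination h1

end
end

section
/- Let Γ ⊂ ℤ^n be an almost periodic pattern, ε > 0 and ℓ ∈ ℕ, ℓ ≥ 1. Then there exists ε' > 0 such that, with N_{ε'} a set of ε'-translations of Γ and R_{ε'} > 0 the corresponding radius, for all integers k_1,…,k_n ∈ {−ℓ,…,ℓ} and all v_1,…,v_n ∈ N_{ε'}, one has D_R^+((Γ + Σ_{i=1}^n k_i v_i) Δ Γ) < ε for every R ≥ R_{ε'}. -/
open Filter MeasureTheory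
open scoped BigOperators

noncomputable section

theorem intVec_add {n : ℕ} (a b : Fin n → ℤ) : intVec (a + b) = intVec a + intVec b := by
  ext i; simp [intVec]

theorem intVec_neg {n : ℕ} (a : Fin n → ℤ) : intVec (-a) = -intVec a := by
  ext i; simp [intVec]

theorem intVec_zero {n : ℕ} : intVec (0 : Fin n → ℤ) = 0 := by
  ext i; simp [intVec]

theorem mem_translateSet {n : ℕ} {Γ : Set (Fin n → ℝ)} {v x : Fin n → ℝ} :
    x ∈ translateSet Γ v ↔ x - v ∈ Γ := by
  simp [translateSet, sub_eq_add_neg]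

theorem translateSet_intPoints {n : ℕ} (w : Fin n → ℤ) :
    translateSet (intPoints n) (intVec w) = intPoints n := by
  ext x
  rw [mem_translateSet]
  constructor
  · rintro ⟨a, ha⟩
    exact ⟨a + w, by rw [intVec_add, ha, sub_add_cancel]⟩
  · rintro ⟨a, rfl⟩
    exact ⟨a + -w, by rw [intVec_add, intVec_neg, sub_eq_add_neg]⟩

theorem translateSet_subset_intPoints {n : ℕ} {Γ : Set (Fin n → ℝ)} (hΓ : Γ ⊆ intPoints n)
    (w : Fin n → ℤ) : translateSet Γ (intVec w) ⊆ intPoints n :=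
  (Set.image_mono hΓ).trans (translateSet_intPoints w).subset

theorem symmDiff_translateSet_subset_intPoints {n : ℕ} {Γ : Set (Fin n → ℝ)}
    (hΓ : Γ ⊆ intPoints n) (w : Fin n → ℤ) :
    symmDiff (translateSet Γ (intVec w)) Γ ⊆ intPoints n :=
  Set.symmDiff_subset_union.trans
    (Set.union_subset (translateSet_subset_intPoints hΓ w) hΓ)

theorem finite_ball_inter_intPoints {n : ℕ} (x : Fin n → ℝ) (R : ℝ) :
    (Metric.ball x R ∩ intPoints n).Finite := by
  refine ((Set.Finite.pi' fun i => Set.finite_Icc ⌊x i - R⌋ ⌈x i + R⌉).image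
    (intVec (n := n))).subset ?_
  rintro _ ⟨hy, a, rfl⟩
  refine ⟨a, fun i => ?_, rfl⟩
  have h := (dist_le_pi_dist (intVec a) x i).trans_lt hy
  rw [Real.dist_eq, abs_lt] at h
  simp only [intVec] at h
  constructor
  · exact_mod_cast (Int.floor_le (x i - R)).trans (show x i - R ≤ (a i : ℝ) by linarith)
  · exact_mod_cast (show (a i : ℝ) ≤ x i + R by linarith).trans (Int.le_ceil _)

theorem bddAbove_ballDensity {n : ℕ} {A : Set (Fin n → ℝ)} (hA : A ⊆ intPoints n) (R : ℝ) :
    BddAbove (Set.range fun x : Fin n → ℝ =>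
      ((Metric.ball x R ∩ A).ncard : ℝ) / ((Metric.ball x R ∩ intPoints n).ncard : ℝ)) := by
  refine ⟨1, ?_⟩
  rintro _ ⟨x, rfl⟩
  refine div_le_one_of_le₀ ?_ (Nat.cast_nonneg _)
  exact_mod_cast Set.ncard_le_ncard (Set.inter_subset_inter_right _ hA)
    (finite_ball_inter_intPoints x R)

theorem DRplus_empty {n : ℕ} (R : ℝ) : DRplus (∅ : Set (Fin n → ℝ)) R = 0 := by
  simp [DRplus]

theorem DRplus_mono {n : ℕ} {A B : Set (Fin n → ℝ)} (hAB : A ⊆ B) (hB : B ⊆ intPoints n)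
    (R : ℝ) : DRplus A R ≤ DRplus B R := by
  refine ciSup_mono (bddAbove_ballDensity hB R) fun x => ?_
  gcongr
  exact (finite_ball_inter_intPoints x R).subset (Set.inter_subset_inter_right _ hB)

theorem DRplus_union_le {n : ℕ} {A B : Set (Fin n → ℝ)} (hA : A ⊆ intPoints n)
    (hB : B ⊆ intPoints n) (R : ℝ) : DRplus (A ∪ B) R ≤ DRplus A R + DRplus B R := by
  refine ciSup_le fun x => ?_
  refine le_trans ?_ (add_le_add (le_ciSup (bddAbove_ballDensity hA R) x)
    (le_ciSup (bddAbove_ballDensity hB R) x))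
  rw [← add_div, Set.inter_union_distrib_left]
  gcongr
  exact_mod_cast Set.ncard_union_le _ _

theorem ncard_ball_inter_translateSet {n : ℕ} (A : Set (Fin n → ℝ)) (v x : Fin n → ℝ) (R : ℝ) :
    (Metric.ball (x + v) R ∩ translateSet A v).ncard = (Metric.ball x R ∩ A).ncard := by
  rw [← Set.ncard_image_of_injective (Metric.ball x R ∩ A) (add_left_injective v),
    Set.image_inter (add_left_injective v)]
  congr 2
  ext y
  simp [dist_eq_norm, ← sub_eq_add_neg, sub_sub, add_comm]

theorem DRplus_translateSet {n : ℕ} (A : Set (Fin n → ℝ)) (w : Fin n → ℤ) (R : ℝ) :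
    DRplus (translateSet A (intVec w)) R = DRplus A R := by
  refine ((Equiv.addRight (intVec w)).iSup_congr fun x => ?_).symm
  have h := ncard_ball_inter_translateSet (intPoints n) (intVec w) x R
  rw [translateSet_intPoints] at h
  rw [Equiv.coe_addRight, ncard_ball_inter_translateSet, h]

/-- The defect of invariance of `Γ` under an integer translation is subadditive. -/
theorem DRplus_symmDiff_translateSet_add_le {n : ℕ} {Γ : Set (Fin n → ℝ)}
    (hΓ : Γ ⊆ intPoints n) (a b : Fin n → ℤ) (R : ℝ) :
    DRplus (symmDiff (translateSet Γ (intVec (a + b))) Γ) R ≤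
      DRplus (symmDiff (translateSet Γ (intVec a)) Γ) R +
        DRplus (symmDiff (translateSet Γ (intVec b)) Γ) R := by
  have ha := symmDiff_translateSet_subset_intPoints hΓ a
  have hb := symmDiff_translateSet_subset_intPoints hΓ b
  have ha' := translateSet_subset_intPoints ha b
  rw [← DRplus_translateSet (symmDiff (translateSet Γ (intVec a)) Γ) b R]
  refine (DRplus_mono ?_ (Set.union_subset ha' hb) R).trans (DRplus_union_le ha' hb R)
  intro x
  have h : x - (intVec a + intVec b) = x - intVec b - intVec a := by abel
  simp only [Set.mem_union, Set.mem_symmDiff, mem_translateSet, intVec_add, h]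
  tauto

theorem DRplus_symmDiff_translateSet_neg {n : ℕ} (Γ : Set (Fin n → ℝ)) (a : Fin n → ℤ)
    (R : ℝ) :
    DRplus (symmDiff (translateSet Γ (intVec (-a))) Γ) R =
      DRplus (symmDiff (translateSet Γ (intVec a)) Γ) R := by
  rw [← DRplus_translateSet _ a]
  congr 1
  ext x
  simp only [Set.mem_symmDiff, mem_translateSet, intVec_neg, sub_neg_eq_add, sub_add_cancel]
  tauto

theorem DRplus_symmDiff_translateSet_zero {n : ℕ} (Γ : Set (Fin n → ℝ)) (R : ℝ) :
    DRplus (symmDiff (translateSet Γ (intVec 0)) Γ) R = 0 := by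
  simp [intVec_zero, translateSet, DRplus_empty]

theorem DRplus_symmDiff_translateSet_nsmul_le {n : ℕ} {Γ : Set (Fin n → ℝ)}
    (hΓ : Γ ⊆ intPoints n) (m : ℕ) (a : Fin n → ℤ) (R : ℝ) :
    DRplus (symmDiff (translateSet Γ (intVec (m • a))) Γ) R ≤
      m * DRplus (symmDiff (translateSet Γ (intVec a)) Γ) R := by
  induction m with
  | zero => simp [DRplus_symmDiff_translateSet_zero]
  | succ m ih =>
    rw [succ_nsmul]
    refine (DRplus_symmDiff_translateSet_add_le hΓ _ _ R).trans ?_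
    push_cast
    linarith

theorem DRplus_symmDiff_translateSet_zsmul_le {n : ℕ} {Γ : Set (Fin n → ℝ)}
    (hΓ : Γ ⊆ intPoints n) (k : ℤ) (a : Fin n → ℤ) (R : ℝ) :
    DRplus (symmDiff (translateSet Γ (intVec (k • a))) Γ) R ≤
      k.natAbs * DRplus (symmDiff (translateSet Γ (intVec a)) Γ) R := by
  rcases k.natAbs_eq with h | h <;> rw [h]
  · simpa using DRplus_symmDiff_translateSet_nsmul_le hΓ k.natAbs a R
  · rw [neg_smul, DRplus_symmDiff_translateSet_neg]
    simpa using DRplus_symmDiff_translateSet_nsmul_le hΓ k.natAbs a R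

theorem DRplus_symmDiff_translateSet_sum_le {n : ℕ} {Γ : Set (Fin n → ℝ)}
    (hΓ : Γ ⊆ intPoints n) {ι : Type*} (s : Finset ι) (a : ι → Fin n → ℤ) (R : ℝ) :
    DRplus (symmDiff (translateSet Γ (intVec (∑ i ∈ s, a i))) Γ) R ≤
      ∑ i ∈ s, DRplus (symmDiff (translateSet Γ (intVec (a i))) Γ) R := by
  classical
  induction s using Finset.induction_on with
  | empty => simp [DRplus_symmDiff_translateSet_zero]
  | insert i s hi ih =>
    rw [Finset.sum_insert hi, Finset.sum_insert hi]
    exact (DRplus_symmDiff_translateSet_add_le hΓ _ _ R).trans (by gcongr)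

/-- The set of `ε`-translations contains arbitrarily large patches of lattices: integer
combinations `Σ k_i v_i` with `|k_i| ≤ ℓ` of `ε'`-translations are `ε`-translations. -/
theorem statement14 {n : ℕ} (Γ : Set (Fin n → ℝ)) (hΓ : AlmostPeriodicPattern Γ)
    (ε : ℝ) (hε : 0 < ε) (ℓ : ℕ) (hℓ : 1 ≤ ℓ) :
    ∃ ε' > 0, ∀ Rε' : ℝ, 0 < Rε' → ∀ N : Set (Fin n → ℝ),
      IsEpsTranslationSet Γ ε' Rε' N →
      ∀ k : Fin n → ℤ, (∀ i, |k i| ≤ (ℓ : ℤ)) →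
      ∀ v : Fin n → (Fin n → ℝ), (∀ i, v i ∈ N) →
      ∀ R, Rε' ≤ R →
        DRplus (symmDiff (translateSet Γ (∑ i, (k i : ℝ) • v i)) Γ) R < ε := by
  have hΓ' := hΓ.1
  refine ⟨ε / (n * ℓ + 1), by positivity, ?_⟩
  intro Rε' _ N hN k hk v hv R hR
  choose w hw using fun i => hN.1 (hv i)
  have hsum : ∑ i, (k i : ℝ) • v i = intVec (∑ i, k i • w i) := by
    ext j
    simp [intVec, ← hw]
  have hterm (i : Fin n) :
      DRplus (symmDiff (translateSet Γ (intVec (k i • w i))) Γ) R ≤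
        ℓ * (ε / (n * ℓ + 1)) := by
    have hki : (k i).natAbs ≤ ℓ := by
      have := hk i
      rw [Int.abs_eq_natAbs] at this
      exact_mod_cast this
    have hvi := hN.2.2 R hR (v i) (hv i)
    rw [← hw i] at hvi
    refine (DRplus_symmDiff_translateSet_zsmul_le hΓ' (k i) (w i) R).trans ?_
    calc _ ≤ ((k i).natAbs : ℝ) * (ε / (n * ℓ + 1)) := by gcongr
      _ ≤ _ := by gcongr
  rw [hsum]
  calc _ ≤ ∑ i : Fin n, (ℓ : ℝ) * (ε / (n * ℓ + 1)) :=
        (DRplus_symmDiff_translateSet_sum_le hΓ' _ _ R).trans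
          (Finset.sum_le_sum fun i _ => hterm i)
    _ = n * ℓ * ε / (n * ℓ + 1) := by simp; ring
    _ < ε := by
      rw [div_lt_iff₀ (by positivity)]
      linarith

end
end
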